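/- Let d ≥ 2, μ > −1/2, and let v be the Uvarov modification ⟨v,p⟩ = ⟨u_μ,p⟩ + λ p(0) of the ball moment functional by a mass λ at the origin; assume v is quasi-definite. Define Q^n_{j,k}(x) = P^n_{⌊n/2⌋,1}(x;μ) − a_n K_{n−1}(u_μ; x, 0) when n is even, j = ⌊n/2⌋ and k = 1, and Q^n_{j,k}(x) = P^n_{j,k}(x;μ) in all other cases, where a_n = λ P^n_{⌊n/2⌋,1}(0;μ) / (1 + λ K_{n−1}(u_μ;0,0)). Then {Q^n_{j,k}} is an orthogonal basis with respect to v, and the kernels satisfy K_n(v;x,y) = K_n(u_μ;x,y) − b_n P_{⌊n/2⌋}^{(d/2, μ−1/2)}(1−2‖x‖²) P_{⌊n/2⌋}^{(d/2, μ−1/2)}(1−2‖y‖²), where b_n = ( λ / (1 + λ K_n(u_μ;0,0)) ) · [ (μ+(d+1)/2)_{⌊n/2⌋} / (μ+1/2)_{⌊n/2⌋} ]². -/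

import Mathlib

open MvPolynomial Matrix

/-- The index set for monomials of total degree `n` in `d` variables:
multi-indices (exponent tuples) summing to `n`. Its cardinality is `r_n^d = C(n+d-1,n)`. -/
abbrev Idx (d n : ℕ) : Type := {ν : Fin d → ℕ // ν ∈ Finset.Nat.antidiagonalTuple d n}

/-- The monomial `x^ν` associated with a multi-index `ν` of total degree `n`;
the family `fun α : Idx d n => monIdx α` is the canonical vector `𝕏_n`. -/
noncomputable def monIdx {d n : ℕ} (α : Idx d n) : MvPolynomial (Fin d) ℝ :=
  MvPolynomial.monomial (Finsupp.equivFunOnFinite.symm α.1) 1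

/-- A polynomial system (PS): a sequence of vectors `ℙ_n` of size `r_n^d` whose
entries are polynomials of total degree `n`, the entries of `ℙ_0,…,ℙ_n` forming a
basis of the polynomials of total degree at most `n`. -/
structure PolySystem (d : ℕ) where
  vec : (n : ℕ) → Idx d n → MvPolynomial (Fin d) ℝ
  degree_eq : ∀ n α, (vec n α).totalDegree = n
  indep : LinearIndependent ℝ (fun p : (Σ n : ℕ, Idx d n) => vec p.1 p.2)
  spans : ∀ (n : ℕ) (p : MvPolynomial (Fin d) ℝ), p.totalDegree ≤ n →
    p ∈ Submodule.span ℝ {q | ∃ m ≤ n, ∃ α : Idx d m, q = vec m α}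

/-- `{ℙ_n}` is an orthogonal polynomial system (OPS) with respect to the moment
functional `u` : `⟨u, 𝕏_m ℙ_n^t⟩ = 0` for `m < n` and `⟨u, 𝕏_n ℙ_n^t⟩` nonsingular. -/
def IsOPS {d : ℕ} (u : MvPolynomial (Fin d) ℝ →ₗ[ℝ] ℝ) (P : PolySystem d) : Prop :=
  (∀ m n : ℕ, m < n → ∀ (α : Idx d m) (β : Idx d n), u (monIdx α * P.vec n β) = 0) ∧
  (∀ n : ℕ, IsUnit (Matrix.of fun α β : Idx d n => u (monIdx α * P.vec n β)).det)

/-- `u` is quasi-definite iff it admits an OPS. -/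
def QuasiDefinite {d : ℕ} (u : MvPolynomial (Fin d) ℝ →ₗ[ℝ] ℝ) : Prop :=
  ∃ P : PolySystem d, IsOPS u P

/-- `H_n = ⟨u, ℙ_n ℙ_n^t⟩`. -/
noncomputable def Hmat {d : ℕ} (u : MvPolynomial (Fin d) ℝ →ₗ[ℝ] ℝ) (P : PolySystem d)
    (n : ℕ) : Matrix (Idx d n) (Idx d n) ℝ :=
  Matrix.of fun α β => u (P.vec n α * P.vec n β)

/-- `P_m(u;x,y) = ℙ_m(x)^t H_m⁻¹ ℙ_m(y)`. -/
noncomputable def kerP {d : ℕ} (u : MvPolynomial (Fin d) ℝ →ₗ[ℝ] ℝ) (P : PolySystem d)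
    (m : ℕ) (x y : Fin d → ℝ) : ℝ :=
  ∑ α, ∑ β, eval x (P.vec m α) * (Hmat u P m)⁻¹ α β * eval y (P.vec m β)

/-- `kerLT u P n = K_{n-1}(u;·,·) = Σ_{m<n} P_m(u;·,·)`, so that `kerLT u P 0 = K_{-1} = 0`. -/
noncomputable def kerLT {d : ℕ} (u : MvPolynomial (Fin d) ℝ →ₗ[ℝ] ℝ) (P : PolySystem d)
    (n : ℕ) (x y : Fin d → ℝ) : ℝ :=
  ∑ m ∈ Finset.range n, kerP u P m x y

/-- `𝖯_n(ξ) = (ℙ_n(ξ_1)|⋯|ℙ_n(ξ_N))`. -/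
noncomputable def Pmat {d N : ℕ} (P : PolySystem d) (ξ : Fin N → (Fin d → ℝ)) (n : ℕ) :
    Matrix (Idx d n) (Fin N) ℝ :=
  Matrix.of fun α i => eval (ξ i) (P.vec n α)

/-- `Kmat u P ξ n = 𝒦_{n-1} = (K_{n-1}(u;ξ_i,ξ_j))_{i,j}`, with `𝒦_{-1} = 0`. -/
noncomputable def Kmat {d N : ℕ} (u : MvPolynomial (Fin d) ℝ →ₗ[ℝ] ℝ) (P : PolySystem d)
    (ξ : Fin N → (Fin d → ℝ)) (n : ℕ) : Matrix (Fin N) (Fin N) ℝ :=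
  Matrix.of fun i j => kerLT u P n (ξ i) (ξ j)

/-- `Kvec u P ξ n x = 𝖪_{n-1}(ξ,x) = (K_{n-1}(u;ξ_1,x),…,K_{n-1}(u;ξ_N,x))^t`, with `𝖪_{-1}=0`. -/
noncomputable def Kvec {d N : ℕ} (u : MvPolynomial (Fin d) ℝ →ₗ[ℝ] ℝ) (P : PolySystem d)
    (ξ : Fin N → (Fin d → ℝ)) (n : ℕ) (x : Fin d → ℝ) : Fin N → ℝ :=
  fun i => kerLT u P n (ξ i) x

/-- A PS is monic if the degree-`n` homogeneous part of the entry of `ℙ_n` indexed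
by `α` is exactly the monomial `x^α`. -/
def PolySystem.IsMonic {d : ℕ} (P : PolySystem d) : Prop :=
  ∀ (n : ℕ) (α : Idx d n) (ν : Fin d →₀ ℕ), (ν.sum fun _ e => e) = n →
    MvPolynomial.coeff ν (P.vec n α) = if ν = Finsupp.equivFunOnFinite.symm α.1 then 1 else 0

/-- Multiplication of a real matrix times a vector of polynomials. -/
noncomputable def matVec {d : ℕ} {a b : Type} [Fintype b] (M : Matrix a b ℝ)
    (w : b → MvPolynomial (Fin d) ℝ) (i : a) : MvPolynomial (Fin d) ℝ :=
  ∑ j, M i j • w j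

/-- The matrix `L_{n,i}` determined by `x_i 𝕏_n = L_{n,i} 𝕏_{n+1}`. -/
noncomputable def Lmat (d n : ℕ) (i : Fin d) : Matrix (Idx d n) (Idx d (n + 1)) ℝ :=
  Matrix.of fun α β => if β.1 = (fun j => α.1 j + if j = i then 1 else 0) then 1 else 0

/-- The unique multi-index of degree 0. -/
def zeroIdx {d : ℕ} : Idx d 0 :=
  ⟨fun _ => 0, by simp [Finset.Nat.mem_antidiagonalTuple]⟩

/-- The degree-2 multi-index `e_i + e_j`. -/
def e2 {d : ℕ} (i j : Fin d) : Idx d 2 :=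
  ⟨fun k => (if k = i then 1 else 0) + (if k = j then 1 else 0), by
    simp [Finset.Nat.mem_antidiagonalTuple, Finset.sum_add_distrib]⟩

/-- `A_{h,2} = Σ_{1≤i≤j≤d} a^{(2)}_{ij} L_{h,j} L_{h+1,i}`. -/
noncomputable def Amat2 {d : ℕ} (a2 : Idx d 2 → ℝ) (h : ℕ) :
    Matrix (Idx d h) (Idx d (h + 2)) ℝ :=
  ∑ i : Fin d, ∑ j : Fin d,
    if i ≤ j then a2 (e2 i j) • (Lmat d h j * Lmat d (h + 1) i) else 0

/-- The polynomial `λ(x) = a_2·𝕏_2 + a_1·𝕏_1 + a_0`. -/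
noncomputable def lamPoly {d : ℕ} (a2 : Idx d 2 → ℝ) (a1 : Idx d 1 → ℝ) (a0 : ℝ) :
    MvPolynomial (Fin d) ℝ :=
  (∑ α : Idx d 2, a2 α • monIdx α) + (∑ α : Idx d 1, a1 α • monIdx α) + MvPolynomial.C a0

open MeasureTheory

/-- Generalized binomial coefficient `C(a,k) = a(a-1)⋯(a-k+1)/k!` for real `a`. -/
noncomputable def genBinom (a : ℝ) (k : ℕ) : ℝ :=
  (∏ j ∈ Finset.range k, (a - j)) / (Nat.factorial k)

/-- The Pochhammer symbol `(a)_m = a(a+1)⋯(a+m-1)`. -/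
noncomputable def poch (a : ℝ) (m : ℕ) : ℝ := (ascPochhammer ℝ m).eval a

/-- The classical Jacobi polynomial `P_n^{(α,β)}` (Szegő's normalization), as a
univariate real polynomial:
`P_n^{(α,β)}(t) = Σ_{s=0}^n C(n+α, n-s) C(n+β, s) ((t-1)/2)^s ((t+1)/2)^{n-s}`. -/
noncomputable def jacobiPoly (α β : ℝ) (n : ℕ) : Polynomial ℝ :=
  ∑ s ∈ Finset.range (n + 1),
    Polynomial.C (genBinom (n + α) (n - s) * genBinom (n + β) s * (1 / 2) ^ n) *
      (Polynomial.X - 1) ^ s * (Polynomial.X + 1) ^ (n - s)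

/-- Evaluation of the Jacobi polynomial at a real point. -/
noncomputable def jacobiP (α β : ℝ) (n : ℕ) (t : ℝ) : ℝ := (jacobiPoly α β n).eval t

/-- The normalizing constant `h_{j,n}(μ)` for the orthonormal ball polynomials. -/
noncomputable def hjn (d : ℕ) (μ : ℝ) (j n : ℕ) : ℝ :=
  Real.sqrt ((poch (μ + 1 / 2) j * poch ((d : ℝ) / 2) (n - j) *
      ((n : ℝ) - (j : ℝ) + μ + ((d : ℝ) - 1) / 2)) /
    ((Nat.factorial j : ℝ) * poch (μ + ((d : ℝ) + 1) / 2) (n - j) *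
      ((n : ℝ) + μ + ((d : ℝ) - 1) / 2)))

/-- The Laplace operator on polynomials, `Δ = Σ_i ∂²/∂x_i²`. -/
noncomputable def mvLaplacian (d : ℕ) :
    MvPolynomial (Fin d) ℝ →ₗ[ℝ] MvPolynomial (Fin d) ℝ :=
  ∑ i : Fin d, ((MvPolynomial.pderiv i).toLinearMap ∘ₗ (MvPolynomial.pderiv i).toLinearMap)

/-- `p` is a harmonic polynomial, homogeneous of degree `m`. -/
def IsHarmonicHomogeneous {d : ℕ} (p : MvPolynomial (Fin d) ℝ) (m : ℕ) : Prop :=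
  p.IsHomogeneous m ∧ mvLaplacian d p = 0

/-- `σ_m = dim ℋ_m^d`, the dimension of the space of harmonic polynomials in `d`
variables homogeneous of degree `m`. -/
noncomputable def sigmaH (d m : ℕ) : ℕ :=
  Module.finrank ℝ
    ↥((MvPolynomial.homogeneousSubmodule (Fin d) ℝ m) ⊓ LinearMap.ker (mvLaplacian d))

/-- The closed unit ball in `ℝ^d`. -/
def ballSet (d : ℕ) : Set (Fin d → ℝ) := {x | ∑ i, x i ^ 2 ≤ 1}

/-- The normalizing constant `ω_μ = Γ(μ+(d+1)/2)/(π^{d/2}Γ(μ+1/2))`. -/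
noncomputable def omegaMu (d : ℕ) (μ : ℝ) : ℝ :=
  Real.Gamma (μ + ((d : ℝ) + 1) / 2) /
    (Real.pi ^ ((d : ℝ) / 2) * Real.Gamma (μ + 1 / 2))

/-- `u` is the classical ball moment functional
`⟨u_μ, p⟩ = ω_μ ∫_{𝔹^d} p(x)(1-‖x‖²)^{μ-1/2} dx`. -/
def IsBallFunctional (d : ℕ) (μ : ℝ) (u : MvPolynomial (Fin d) ℝ →ₗ[ℝ] ℝ) : Prop :=
  ∀ p : MvPolynomial (Fin d) ℝ,
    u p = omegaMu d μ *
      ∫ x in ballSet d, (eval x p) * (1 - ∑ i, x i ^ 2) ^ (μ - 1 / 2 : ℝ)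

/-- The orthonormal ball polynomial
`P^n_{j,·}(x;μ) = h_{j,n}(μ)⁻¹ P_j^{(μ-1/2,n-2j+(d-2)/2)}(2‖x‖²-1) Y(x)`,
evaluated at `x`, for a harmonic polynomial `Y` homogeneous of degree `n-2j`. -/
noncomputable def ballPval (d : ℕ) (μ : ℝ) (n j : ℕ) (Y : MvPolynomial (Fin d) ℝ)
    (x : Fin d → ℝ) : ℝ :=
  (hjn d μ j n)⁻¹ *
    jacobiP (μ - 1 / 2) ((n : ℝ) - 2 * (j : ℝ) + ((d : ℝ) - 2) / 2) j
      (2 * (∑ i, x i ^ 2) - 1) * eval x Y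

/-- `‖x‖² = Σ_i x_i²` as a polynomial. -/
noncomputable def sqNormPoly (d : ℕ) : MvPolynomial (Fin d) ℝ := ∑ i, X i ^ 2

/-- The ball polynomial `P^n_{j,k}(·;μ) = h_{j,n}(μ)⁻¹P_j^{(μ-1/2,n-2j+(d-2)/2)}(2‖x‖²-1)Y_k^{n-2j}`
as a polynomial, built from a family `Y` of spherical harmonics. -/
noncomputable def ballPPoly (d : ℕ) (μ : ℝ) (Y : ℕ → ℕ → MvPolynomial (Fin d) ℝ)
    (n j k : ℕ) : MvPolynomial (Fin d) ℝ :=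
  (hjn d μ j n)⁻¹ •
    (Polynomial.aeval (2 * sqNormPoly d - 1)
        (jacobiPoly (μ - 1 / 2) ((n : ℝ) - 2 * (j : ℝ) + ((d : ℝ) - 2) / 2) j) *
      Y (n - 2 * j) k)

/-- The kernel `K_{n-1}(u;x,y)` built from an orthonormal family:
`famKerLT Pf sig n x y = Σ_{m<n} Σ_{j≤m/2} Σ_{1≤k≤σ_{m-2j}} Pf_{m,j,k}(x)Pf_{m,j,k}(y)`. -/
noncomputable def famKerLT {d : ℕ} (Pf : ℕ → ℕ → ℕ → MvPolynomial (Fin d) ℝ)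
    (sig : ℕ → ℕ) (n : ℕ) (x y : Fin d → ℝ) : ℝ :=
  ∑ m ∈ Finset.range n, ∑ j ∈ Finset.range (m / 2 + 1),
    ∑ k ∈ Finset.Icc 1 (sig (m - 2 * j)),
      eval x (Pf m j k) * eval y (Pf m j k)

/-- The kernel `K_{n-1}(u;·,0)` as a polynomial. -/
noncomputable def famKerPolyLT {d : ℕ} (Pf : ℕ → ℕ → ℕ → MvPolynomial (Fin d) ℝ)
    (sig : ℕ → ℕ) (n : ℕ) : MvPolynomial (Fin d) ℝ :=
  ∑ m ∈ Finset.range n, ∑ j ∈ Finset.range (m / 2 + 1),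
    ∑ k ∈ Finset.Icc 1 (sig (m - 2 * j)),
      (eval 0 (Pf m j k)) • Pf m j k

/-- The Uvarov-modified ball polynomials
`Q^n_{j,k} = P^n_{⌊n/2⌋,1}(·;μ) - a_n K_{n-1}(u_μ;·,0)` if `n` even, `j=⌊n/2⌋`, `k=1`,
and `Q^n_{j,k} = P^n_{j,k}(·;μ)` otherwise, where
`a_n = λP^n_{⌊n/2⌋,1}(0;μ)/(1+λK_{n-1}(u_μ;0,0))`. -/
noncomputable def ballUvarovQ {d : ℕ} (lam : ℝ) (Pf : ℕ → ℕ → ℕ → MvPolynomial (Fin d) ℝ)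
    (sig : ℕ → ℕ) (n j k : ℕ) : MvPolynomial (Fin d) ℝ :=
  if Even n ∧ j = n / 2 ∧ k = 1 then
    Pf n j k -
      (lam * eval 0 (Pf n (n / 2) 1) / (1 + lam * famKerLT Pf sig n 0 0)) •
        famKerPolyLT Pf sig n
  else Pf n j k

lemma integral_rpow_mul_one_sub_rpow {a b : ℝ} (ha : 0 < a) (hb : 0 < b) :
    ∫ x in Set.Ioc (0 : ℝ) 1, x ^ (a - 1) * (1 - x) ^ (b - 1) =
      ProbabilityTheory.beta a b := by
  rw [ProbabilityTheory.beta_eq_betaIntegralReal a b ha hb, Complex.betaIntegral,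
    intervalIntegral.integral_of_le (by norm_num), ← RCLike.re_eq_complex_re, ← integral_re]
  · refine setIntegral_congr_fun measurableSet_Ioc fun x ⟨hx1, hx2⟩ ↦ ?_
    norm_cast
    rw [← Complex.ofReal_cpow, ← Complex.ofReal_cpow, RCLike.re_eq_complex_re,
      Complex.re_mul_ofReal, Complex.ofReal_re]
    all_goals linarith
  · convert! Complex.betaIntegral_convergent (u := a) (v := b) (by simpa) (by simpa)
    rw [intervalIntegrable_iff_integrableOn_Ioc_of_le (by simp), IntegrableOn]

lemma integral_pow_mul_one_sub_sq_rpow {d : ℕ} (hd : 1 ≤ d) {b : ℝ} (hb : 0 < b) :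
    ∫ y in Set.Ioi (0 : ℝ), y ^ (d - 1) * (if y ^ 2 ≤ 1 then (1 - y ^ 2) ^ (b - 1) else 0) =
      ProbabilityTheory.beta ((d : ℝ) / 2) b / 2 := by
  have hd0 : (0 : ℝ) < d := by exact_mod_cast hd
  have h := integral_comp_rpow_Ioi_of_pos
    (g := (Set.Ioc (0 : ℝ) 1).indicator fun x => x ^ ((d : ℝ) / 2 - 1) * (1 - x) ^ (b - 1))
    (p := 2) two_pos
  rw [setIntegral_indicator measurableSet_Ioc,
    Set.inter_eq_self_of_subset_right Set.Ioc_subset_Ioi_self,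
    integral_rpow_mul_one_sub_rpow (by positivity) hb] at h
  rw [← h, ← integral_div]
  refine setIntegral_congr_fun measurableSet_Ioi fun y hy => ?_
  have hy : 0 < y := hy
  have hpow : y ^ (d - 1) = y * (y ^ 2) ^ ((d : ℝ) / 2 - 1) := by
    rw [← Real.rpow_natCast y 2, ← Real.rpow_mul hy.le]
    nth_rewrite 2 [← Real.rpow_one y]
    rw [← Real.rpow_add hy, ← Real.rpow_natCast, Nat.cast_sub hd]
    congr 1
    push_cast
    ring
  by_cases hy1 : y ^ 2 ≤ 1
  · have hmem : y ^ 2 ∈ Set.Ioc (0 : ℝ) 1 := ⟨by positivity, hy1⟩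
    simp only [hy1, if_true, smul_eq_mul, Real.rpow_two, Set.indicator_of_mem hmem, hpow]
    norm_num
    ring
  · have hmem : y ^ 2 ∉ Set.Ioc (0 : ℝ) 1 := fun h => hy1 h.2
    simp [hy1, hmem]

lemma integral_ballSet_weight {d : ℕ} (hd : 1 ≤ d) {b : ℝ} (hb : 0 < b) :
    ∫ x in ballSet d, (1 - ∑ i, x i ^ 2) ^ (b - 1) =
      Real.pi ^ ((d : ℝ) / 2) * Real.Gamma b / Real.Gamma ((d : ℝ) / 2 + b) := by
  have : Nonempty (Fin d) := ⟨⟨0, hd⟩⟩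
  have hd0 : (0 : ℝ) < d := by exact_mod_cast hd
  have hmeas : MeasurableSet (ballSet d) := by
    apply measurableSet_le <;> fun_prop
  have hrad := integral_fun_norm_addHaar (volume : Measure (EuclideanSpace ℝ (Fin d)))
    (fun r : ℝ => if r ^ 2 ≤ 1 then (1 - r ^ 2) ^ (b - 1) else 0)
  have hcomp := (EuclideanSpace.volume_preserving_symm_measurableEquiv_toLp (Fin d)).integral_comp'
    (fun x : Fin d → ℝ => (ballSet d).indicator (fun x => (1 - ∑ i, x i ^ 2) ^ (b - 1)) x)
  rw [← integral_indicator hmeas, ← hcomp]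
  have heq : ∀ x : EuclideanSpace ℝ (Fin d),
      (ballSet d).indicator (fun x => (1 - ∑ i, x i ^ 2) ^ (b - 1))
        ((MeasurableEquiv.toLp 2 (Fin d → ℝ)).symm x) =
      (fun r : ℝ => if r ^ 2 ≤ 1 then (1 - r ^ 2) ^ (b - 1) else 0) ‖x‖ := by
    intro x
    simp only [EuclideanSpace.norm_sq_eq, Real.norm_eq_abs, sq_abs, Set.indicator, ballSet]
    rfl
  simp_rw [heq]
  rw [hrad]
  simp only [smul_eq_mul, finrank_euclideanSpace, Fintype.card_fin]
  rw [integral_pow_mul_one_sub_sq_rpow hd hb, Measure.real, EuclideanSpace.volume_ball]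
  have hG : Real.Gamma ((d : ℝ) / 2 + 1) = d / 2 * Real.Gamma ((d : ℝ) / 2) :=
    Real.Gamma_add_one (by positivity)
  have hG0 : 0 < Real.Gamma ((d : ℝ) / 2) := Real.Gamma_pos_of_pos (by positivity)
  have hpi : √Real.pi ^ d = Real.pi ^ ((d : ℝ) / 2) := by
    rw [Real.sqrt_eq_rpow, ← Real.rpow_natCast, ← Real.rpow_mul Real.pi_pos.le]
    congr 1
    ring
  simp only [ENNReal.ofReal_one, one_pow, one_mul, Fintype.card_fin]
  rw [ENNReal.toReal_ofReal (by rw [hG]; positivity), hG, hpi, ProbabilityTheory.beta, nsmul_eq_mul]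
  field_simp

lemma IsBallFunctional.map_one {d : ℕ} (hd : 1 ≤ d) {μ : ℝ} (hμ : -(1 / 2) < μ)
    {u : MvPolynomial (Fin d) ℝ →ₗ[ℝ] ℝ} (hu : IsBallFunctional d μ u) : u 1 = 1 := by
  have hb : 0 < μ + 1 / 2 := by linarith
  have hd0 : (0 : ℝ) < d := by exact_mod_cast hd
  have h := integral_ballSet_weight hd hb
  rw [show μ + 1 / 2 - 1 = μ - 1 / 2 by ring] at h
  have h1 : 0 < Real.Gamma (μ + 1 / 2) := Real.Gamma_pos_of_pos hb
  have h2 : 0 < Real.Gamma ((d : ℝ) / 2 + (μ + 1 / 2)) := Real.Gamma_pos_of_pos (by positivity)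
  have h3 : 0 < Real.pi ^ ((d : ℝ) / 2) := Real.rpow_pos_of_pos Real.pi_pos _
  rw [hu, omegaMu]
  simp only [_root_.map_one, one_mul]
  rw [h, show μ + ((d : ℝ) + 1) / 2 = (d : ℝ) / 2 + (μ + 1 / 2) by ring, div_mul_div_comm, mul_comm]
  exact div_self (mul_pos (mul_pos h3 h1) h2).ne'

lemma genBinom_succ (a : ℝ) (k : ℕ) :
    ((k : ℝ) + 1) * genBinom a (k + 1) = (a - k) * genBinom a k := by
  simp only [genBinom, Finset.prod_range_succ, Nat.factorial_succ]
  have : (Nat.factorial k : ℝ) ≠ 0 := by positivity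
  push_cast
  field_simp

lemma mul_genBinom_sub_one (a : ℝ) (k : ℕ) :
    a * genBinom (a - 1) k = (k + 1) * genBinom a (k + 1) := by
  simp only [genBinom, Finset.prod_range_succ', Nat.factorial_succ]
  have : (Nat.factorial k : ℝ) ≠ 0 := by positivity
  push_cast
  field_simp
  rw [sub_zero, mul_comm a]
  congr 1
  exact Finset.prod_congr rfl fun i _ => by ring

lemma genBinom_add_one_succ (a : ℝ) (k : ℕ) :
    genBinom (a + 1) (k + 1) = genBinom a (k + 1) + genBinom a k := by
  have h := mul_genBinom_sub_one (a + 1) k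
  have h' := genBinom_succ a k
  rw [add_sub_cancel_right] at h
  have hk : ((k : ℝ) + 1) ≠ 0 := by positivity
  apply mul_left_cancel₀ hk
  linear_combination -h' - h

lemma genBinom_zero (a : ℝ) : genBinom a 0 = 1 := by simp [genBinom]

lemma jacobiP_eq_sum (α β : ℝ) (n : ℕ) (t : ℝ) :
    jacobiP α β n t = ∑ s ∈ Finset.range (n + 1),
      genBinom (n + α) (n - s) * genBinom (n + β) s *
        ((t - 1) / 2) ^ s * ((t + 1) / 2) ^ (n - s) := by
  rw [jacobiP, jacobiPoly, Polynomial.eval_finsetSum]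
  refine Finset.sum_congr rfl fun s hs => ?_
  have hs : s ≤ n := by simpa [Nat.lt_succ_iff] using hs
  have : ((1 : ℝ) / 2) ^ n = (1 / 2) ^ s * (1 / 2) ^ (n - s) := by
    rw [← pow_add, Nat.add_sub_cancel' hs]
  simp only [Polynomial.eval_mul, Polynomial.eval_C, Polynomial.eval_pow, Polynomial.eval_sub,
    Polynomial.eval_add, Polynomial.eval_X, Polynomial.eval_one, this]
  rw [div_eq_mul_one_div (t - 1), div_eq_mul_one_div (t + 1), mul_pow, mul_pow]
  ring

lemma jacobiP_neg (α β : ℝ) (n : ℕ) (t : ℝ) :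
    jacobiP α β n (-t) = (-1) ^ n * jacobiP β α n t := by
  rw [jacobiP_eq_sum, jacobiP_eq_sum, ← Finset.sum_range_reflect, Finset.mul_sum]
  refine Finset.sum_congr rfl fun s hs => ?_
  have hs : s ≤ n := by simpa [Nat.lt_succ_iff] using hs
  have : ((-1 : ℝ)) ^ n = (-1) ^ s * (-1) ^ (n - s) := by
    rw [← pow_add, Nat.add_sub_cancel' hs]
  rw [show n + 1 - 1 - s = n - s by omega, Nat.sub_sub_self hs, this,
    show (-t - 1) / 2 = -1 * ((t + 1) / 2) by ring, show (-t + 1) / 2 = -1 * ((t - 1) / 2) by ring,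
    mul_pow, mul_pow]
  ring

lemma jacobiP_neg_one (α β : ℝ) (n : ℕ) :
    jacobiP α β n (-1) = (-1) ^ n * genBinom (n + β) n := by
  rw [jacobiP_eq_sum, Finset.sum_range_succ, Finset.sum_eq_zero]
  · norm_num [genBinom_zero]
    ring
  · intro s hs
    have hs : s < n := by simpa using hs
    norm_num [Nat.sub_eq_zero_iff_le, hs]

lemma genBinom_add_self (n : ℕ) (b : ℝ) :
    genBinom (n + b) n = poch (b + 1) n / Nat.factorial n := by
  have hp : (ascPochhammer ℝ n).eval (b + 1) = ∏ i ∈ Finset.range n, (b + 1 + i) := by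
    induction n with
    | zero => simp
    | succ n ih => rw [ascPochhammer_succ_eval, ih, Finset.prod_range_succ]
  rw [genBinom, poch, hp, ← Finset.prod_range_reflect]
  congr 1
  refine Finset.prod_congr rfl fun i hi => ?_
  have hi : i < n := by simpa using hi
  rw [show n - 1 - i = n - (i + 1) by omega, Nat.cast_sub (by omega)]
  push_cast
  ring

lemma jacobiP_contiguous (α β : ℝ) (n : ℕ) (t : ℝ) :
    (2 * ((n : ℝ) + 1) + α + β + 1) * jacobiP α β (n + 1) t =
      ((n : ℝ) + 1 + α + β + 1) * jacobiP α (β + 1) (n + 1) t +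
        ((n : ℝ) + 1 + α) * jacobiP α (β + 1) n t := by
  simp only [jacobiP_eq_sum]
  set A := (t - 1) / 2 with hA
  set B := (t + 1) / 2 with hB
  have hAB : B - A = 1 := by rw [hA, hB]; ring
  set c : ℕ → ℝ := fun s => genBinom (n + α) (n - s) * genBinom (n + (β + 1)) s with hc
  have hlow : ∑ s ∈ Finset.range (n + 1), c s * A ^ s * B ^ (n - s) =
      ∑ s ∈ Finset.range (n + 1 + 1),
        ((if s = n + 1 then 0 else c s) - (if s = 0 then 0 else c (s - 1))) *
          A ^ s * B ^ (n + 1 - s) := by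
    have h1 : ∑ s ∈ Finset.range (n + 1), c s * A ^ s * B ^ (n - s) =
        ∑ s ∈ Finset.range (n + 1), c s * A ^ s * B ^ (n + 1 - s) -
        ∑ s ∈ Finset.range (n + 1), c s * A ^ (s + 1) * B ^ (n - s) := by
      rw [← Finset.sum_sub_distrib]
      refine Finset.sum_congr rfl fun s hs => ?_
      have hs : s ≤ n := by simpa [Nat.lt_succ_iff] using hs
      rw [Nat.succ_sub hs, pow_succ, pow_succ]
      linear_combination (-c s * A ^ s * B ^ (n - s)) * hAB
    rw [h1]
    simp only [sub_mul, Finset.sum_sub_distrib]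
    congr 1
    · rw [Finset.sum_range_succ _ (n + 1)]
      simp only [if_true, zero_mul, add_zero]
      refine Finset.sum_congr rfl fun s hs => ?_
      rw [if_neg (by simp at hs; omega)]
    · rw [Finset.sum_range_succ' _ (n + 1)]
      simp
  rw [hlow, Finset.mul_sum, Finset.mul_sum, Finset.mul_sum, ← Finset.sum_add_distrib]
  refine Finset.sum_congr rfl fun s hs => ?_
  have hs : s ≤ n + 1 := by simpa [Nat.lt_succ_iff] using hs
  rw [← sub_eq_zero]
  have key : (2 * ((n : ℝ) + 1) + α + β + 1) *
      (genBinom ((n + 1 : ℕ) + α) (n + 1 - s) * genBinom ((n + 1 : ℕ) + β) s) =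
      ((n : ℝ) + 1 + α + β + 1) *
        (genBinom ((n + 1 : ℕ) + α) (n + 1 - s) * genBinom ((n + 1 : ℕ) + (β + 1)) s) +
      ((n : ℝ) + 1 + α) *
        ((if s = n + 1 then 0 else c s) - (if s = 0 then 0 else c (s - 1))) := by
    have e1 : s < n + 1 → ((n : ℝ) + 1 + α) * genBinom (n + α) (n - s) =
        (n + 1 - s) * genBinom (n + 1 + α) (n + 1 - s) := by
      intro h
      have := mul_genBinom_sub_one ((n : ℝ) + 1 + α) (n - s)
      rw [show (n : ℝ) + 1 + α - 1 = n + α by ring, show n - s + 1 = n + 1 - s by omega,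
        Nat.cast_sub (by omega)] at this
      rw [this]
      ring
    have e2 : 0 < s → ((n : ℝ) + 1 + α) * genBinom (n + α) (n - (s - 1)) =
        (α + s) * genBinom (n + 1 + α) (n + 1 - s) := by
      intro h
      have h1 := mul_genBinom_sub_one ((n : ℝ) + 1 + α) (n + 1 - s)
      have h2 := genBinom_succ ((n : ℝ) + 1 + α) (n + 1 - s)
      rw [show (n : ℝ) + 1 + α - 1 = n + α by ring, h2, Nat.cast_sub hs] at h1
      rw [show n - (s - 1) = n + 1 - s by omega, h1]
      push_cast
      ring
    simp only [hc, Nat.cast_add, Nat.cast_one]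
    rcases Nat.eq_zero_or_pos s with rfl | hs0
    · have := e1 (Nat.succ_pos n)
      simp only [Nat.cast_zero, sub_zero] at this
      simp only [genBinom_zero, if_true, (Nat.succ_ne_zero n).symm, if_false]
      linear_combination -this
    · obtain ⟨r, rfl⟩ : ∃ r, s = r + 1 := ⟨s - 1, by omega⟩
      have h2 := e2 hs0
      have h3 := genBinom_add_one_succ ((n : ℝ) + 1 + β) r
      have h4 := genBinom_succ ((n : ℝ) + 1 + β) r
      rw [show (n : ℝ) + (β + 1) = n + 1 + β by ring,
        show (n : ℝ) + 1 + (β + 1) = n + 1 + β + 1 by ring, h3]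
      simp only [Nat.succ_ne_zero, if_false, Nat.add_sub_cancel] at h2 ⊢
      push_cast at h2
      by_cases hsn : r + 1 = n + 1
      · obtain rfl : r = n := by omega
        simp only [if_true]
        simp only [Nat.sub_self, genBinom_zero] at h2 ⊢
        linear_combination h4 + genBinom (r + 1 + β) r * h2
      · have h1 := e1 (by omega)
        push_cast at h1
        rw [if_neg hsn, Nat.add_sub_add_right]
        linear_combination genBinom (n + 1 + α) (n - r) * h4
          + genBinom (n + 1 + β) r * h2 - genBinom (n + 1 + β) (r + 1) * h1
  push_cast at key ⊢
  linear_combination (A ^ s * B ^ (n + 1 - s)) * key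

lemma poch_succ (a : ℝ) (m : ℕ) : poch a (m + 1) = poch a m * (a + m) := by
  rw [poch, ascPochhammer_succ_eval, poch]

lemma poch_pos {a : ℝ} (ha : 0 < a) (m : ℕ) : 0 < poch a m :=
  ascPochhammer_pos m a ha

lemma hjn_two_mul_sq {d : ℕ} (hd : 2 ≤ d) {μ : ℝ} (hμ : -(1 / 2) < μ) (j : ℕ) :
    hjn d μ j (2 * j) ^ 2 =
      (poch (μ + 1 / 2) j * poch ((d : ℝ) / 2) j * (j + μ + ((d : ℝ) - 1) / 2)) /
        (Nat.factorial j * poch (μ + ((d : ℝ) + 1) / 2) j * (2 * j + μ + ((d : ℝ) - 1) / 2)) := by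
  have hd' : (2 : ℝ) ≤ d := by exact_mod_cast hd
  have h1 := poch_pos (show 0 < μ + 1 / 2 by linarith) j
  have h2 := poch_pos (show 0 < (d : ℝ) / 2 by linarith) j
  have h3 := poch_pos (show 0 < μ + ((d : ℝ) + 1) / 2 by linarith) j
  have hj : (0 : ℝ) ≤ j := Nat.cast_nonneg j
  have h4 : 0 < (j : ℝ) + μ + ((d : ℝ) - 1) / 2 := by linarith
  have h5 : 0 < 2 * (j : ℝ) + μ + ((d : ℝ) - 1) / 2 := by linarith
  rw [hjn, show 2 * j - j = j by omega, Nat.cast_mul, Nat.cast_two,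
    show 2 * (j : ℝ) - j = j by ring, Real.sq_sqrt (by positivity)]

/-- The values at `t` and `-1` of the Jacobi kernel, in closed form. -/
lemma sum_jacobiP_mul_jacobiP_neg_one {d : ℕ} (hd : 2 ≤ d) {μ : ℝ} (hμ : -(1 / 2) < μ)
    (m : ℕ) (t : ℝ) :
    ∑ j ∈ Finset.range (m + 1), (hjn d μ j (2 * j) ^ 2)⁻¹ *
        jacobiP (μ - 1 / 2) (((d : ℝ) - 2) / 2) j (-1) *
        jacobiP (μ - 1 / 2) (((d : ℝ) - 2) / 2) j t =
      poch (μ + ((d : ℝ) + 1) / 2) m / poch (μ + 1 / 2) m *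
        jacobiP ((d : ℝ) / 2) (μ - 1 / 2) m (-t) := by
  have hd' : (2 : ℝ) ≤ d := by exact_mod_cast hd
  induction m with
  | zero =>
    have h5 : μ + ((d : ℝ) - 1) / 2 ≠ 0 := by linarith
    simp [hjn_two_mul_sq hd hμ, jacobiP_eq_sum, poch, genBinom_zero, h5]
  | succ m ih =>
    rw [Finset.sum_range_succ, ih, hjn_two_mul_sq hd hμ, jacobiP_neg_one, genBinom_add_self,
      jacobiP_neg, jacobiP_neg, show ((d : ℝ) - 2) / 2 + 1 = d / 2 by ring]
    have hc := jacobiP_contiguous (μ - 1 / 2) (((d : ℝ) - 2) / 2) m t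
    rw [show ((d : ℝ) - 2) / 2 + 1 = d / 2 by ring] at hc
    have h2 := poch_pos (show 0 < (d : ℝ) / 2 by linarith) (m + 1)
    have h1 := poch_pos (show 0 < μ + 1 / 2 by linarith) m
    have h3 := poch_pos (show 0 < μ + ((d : ℝ) + 1) / 2 by linarith) m
    have hm : (0 : ℝ) ≤ m := Nat.cast_nonneg m
    have h4 : 0 < (m : ℝ) + 1 + μ + ((d : ℝ) - 1) / 2 := by linarith
    have h5 : 0 < 2 * ((m : ℝ) + 1) + μ + ((d : ℝ) - 1) / 2 := by linarith
    have h6 : 0 < μ + 1 / 2 + m := by linarith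
    have h7 : 0 < μ + ((d : ℝ) + 1) / 2 + m := by linarith
    have hf : (Nat.factorial (m + 1) : ℝ) ≠ 0 := by positivity
    rw [poch_succ (μ + 1 / 2), poch_succ (μ + ((d : ℝ) + 1) / 2)]
    push_cast
    set x := jacobiP (μ - 1 / 2) (d / 2) m t
    set y := jacobiP (μ - 1 / 2) (d / 2) (m + 1) t
    set z := jacobiP (μ - 1 / 2) (((d : ℝ) - 2) / 2) (m + 1) t
    set p := poch ((d : ℝ) / 2) (m + 1)
    set q := poch (μ + 1 / 2) m
    set r := poch (μ + ((d : ℝ) + 1) / 2) m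
    set A := (m : ℝ) + 1 + μ + ((d : ℝ) - 1) / 2 with hA
    set B := 2 * ((m : ℝ) + 1) + μ + ((d : ℝ) - 1) / 2 with hB
    set C := μ + 1 / 2 + (m : ℝ) with hC
    rw [show μ + ((d : ℝ) + 1) / 2 + m = A by rw [hA]; ring]
    have hz : B * z = A * y + C * x := by
      rw [hA, hB, hC]
      linear_combination hc
    have hz' : z = (A * y + C * x) / B := by
      rw [eq_div_iff h5.ne']
      linear_combination hz
    rw [hz', pow_succ]
    field_simp
    ring

lemma IsOPS.exists_apply_mul_ne_zero {d : ℕ} {v : MvPolynomial (Fin d) ℝ →ₗ[ℝ] ℝ}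
    {P : PolySystem d} (hP : IsOPS v P) {q : MvPolynomial (Fin d) ℝ} (hq : q ≠ 0) :
    ∃ p : MvPolynomial (Fin d) ℝ, p.totalDegree ≤ q.totalDegree ∧ v (q * p) ≠ 0 := by
  by_contra! hcon
  set N := q.totalDegree with hN
  let e : Idx d N ↪ (Fin d →₀ ℕ) :=
    ⟨fun α => Finsupp.equivFunOnFinite.symm α.1,
      Finsupp.equivFunOnFinite.symm.injective.comp Subtype.val_injective⟩
  have hmem : ∀ ν : Fin d →₀ ℕ, ν.degree = N → ∃ α, e α = ν := fun ν hν =>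
    ⟨⟨ν, by rw [Finset.Nat.mem_antidiagonalTuple, ← hν, Finsupp.degree_eq_sum]⟩,
      Finsupp.equivFunOnFinite.symm_apply_apply ν⟩
  have hmul : ∀ (ν : Fin d →₀ ℕ) (c : ℝ) (R : MvPolynomial (Fin d) ℝ),
      v (monomial ν c * R) = c * v (monomial ν 1 * R) := fun ν c R => by
    rw [← smul_eq_mul c (v _), ← map_smul, ← smul_mul_assoc, smul_monomial, smul_eq_mul, mul_one]
  have hle : ∀ ν ∈ q.support, ν.degree ≤ N := fun ν hν => by
    have := MvPolynomial.le_totalDegree hν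
    rwa [hN]
  have hzero : Matrix.vecMul (fun α => coeff (e α) q)
      (Matrix.of fun α β : Idx d N => v (monIdx α * P.vec N β)) = 0 := by
    funext β
    have h := hcon (P.vec N β) (P.degree_eq N β).le
    rw [q.as_sum, Finset.sum_mul, map_sum] at h
    rw [Pi.zero_apply, ← h]
    simp only [Matrix.vecMul, dotProduct, Matrix.of_apply]
    have : ∀ α : Idx d N, coeff (e α) q * v (monIdx α * P.vec N β) =
        v (monomial (e α) (coeff (e α) q) * P.vec N β) := fun α => by
      rw [hmul]
      rfl
    simp_rw [this]
    rw [← Finset.sum_map Finset.univ e fun ν => v (monomial ν (coeff ν q) * P.vec N β)]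
    refine Finset.sum_congr_of_eq_on_inter ?_ ?_ fun _ _ _ => rfl
    · intro ν _ hν
      rw [notMem_support_iff.mp hν, monomial_zero, zero_mul, map_zero]
    · intro ν hν hν'
      have hlt : ν.degree < N := lt_of_le_of_ne (hle ν hν) fun h => hν' <| by
        obtain ⟨α, rfl⟩ := hmem ν h
        simp
      have := hP.1 ν.degree N hlt
        ⟨ν, by rw [Finset.Nat.mem_antidiagonalTuple, Finsupp.degree_eq_sum]⟩ β
      have h1 : Finsupp.equivFunOnFinite.symm ⇑ν = ν :=
        Finsupp.equivFunOnFinite.symm_apply_apply ν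
      rw [monIdx, h1] at this
      rw [hmul, this, mul_zero]
  have hcoeff := Matrix.eq_zero_of_vecMul_eq_zero (hP.2 N).ne_zero hzero
  obtain ⟨ν, hν, hνN⟩ := Finset.exists_mem_eq_sup q.support
    (by simpa [Finset.nonempty_iff_ne_empty] using hq) fun ν => ν.degree
  have hνN : ν.degree = N := by
    rw [hN, ← hνN]
    rfl
  obtain ⟨α, rfl⟩ := hmem ν hνN
  exact mem_support_iff.mp hν (congrFun hcoeff α)

/-- A family of polynomials, orthonormal for `u` on the index set `V`, graded by `lev`, that
spans all polynomials compatibly with the grading; `s n` lists the indices of level `< n`. -/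
structure IsGradedOrthonormal {d : ℕ} {ι : Type*} [DecidableEq ι]
    (u : MvPolynomial (Fin d) ℝ →ₗ[ℝ] ℝ) (P : ι → MvPolynomial (Fin d) ℝ) (lev : ι → ℕ)
    (V : Set ι) (s : ℕ → Finset ι) : Prop where
  mem_iff : ∀ t n, t ∈ s n ↔ t ∈ V ∧ lev t < n
  ortho : ∀ t ∈ V, ∀ t' ∈ V, u (P t * P t') = if t = t' then 1 else 0
  totalDegree_le : ∀ t ∈ V, (P t).totalDegree ≤ lev t
  mem_span : ∀ (N : ℕ) (p : MvPolynomial (Fin d) ℝ), p.totalDegree ≤ N →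
    p ∈ Submodule.span ℝ (P '' (s (N + 1)))

/-- The kernel `∑ t ∈ s, P t (0) P t` with one argument at the origin. -/
noncomputable def kerAtZero {d : ℕ} {ι : Type*} (P : ι → MvPolynomial (Fin d) ℝ)
    (s : Finset ι) : MvPolynomial (Fin d) ℝ :=
  ∑ t ∈ s, eval 0 (P t) • P t

/-- The modification of `P t` by the kernel of the lower levels `s`. -/
noncomputable def uvarovPoly {d : ℕ} {ι : Type*} (lam : ℝ) (P : ι → MvPolynomial (Fin d) ℝ)
    (s : Finset ι) (t : ι) : MvPolynomial (Fin d) ℝ :=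
  P t - (lam * eval 0 (P t) / (1 + lam * eval 0 (kerAtZero P s))) • kerAtZero P s

namespace IsGradedOrthonormal

variable {d : ℕ} {ι : Type*} [DecidableEq ι] {u v : MvPolynomial (Fin d) ℝ →ₗ[ℝ] ℝ}
  {P : ι → MvPolynomial (Fin d) ℝ} {lev : ι → ℕ} {V : Set ι} {s : ℕ → Finset ι} {lam : ℝ}

lemma apply_kerAtZero_mul (h : IsGradedOrthonormal u P lev V s) (n : ℕ) {t : ι} (ht : t ∈ V) :
    u (kerAtZero P (s n) * P t) = if lev t < n then eval 0 (P t) else 0 := by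
  rw [kerAtZero, Finset.sum_mul, map_sum]
  have : ∀ t' ∈ s n, u (eval 0 (P t') • P t' * P t) = if t = t' then eval 0 (P t') else 0 := by
    intro t' ht'
    rw [smul_mul_assoc, map_smul, h.ortho t' ((h.mem_iff _ _).1 ht').1 t ht, smul_eq_mul, mul_ite,
      mul_one, mul_zero]
    simp only [eq_comm]
  rw [Finset.sum_congr rfl this, Finset.sum_ite_eq]
  simp only [h.mem_iff, ht, true_and]

lemma modified_kerAtZero_mul (h : IsGradedOrthonormal u P lev V s)
    (hv : ∀ p, v p = u p + lam * eval 0 p) (n : ℕ) {t : ι} (ht : t ∈ V) :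
    v (kerAtZero P (s n) * P t) = if lev t < n
      then (1 + lam * eval 0 (kerAtZero P (s n))) * eval 0 (P t)
      else lam * eval 0 (kerAtZero P (s n)) * eval 0 (P t) := by
  rw [hv, h.apply_kerAtZero_mul n ht, map_mul]
  split_ifs <;> ring

lemma one_add_ne_zero (h : IsGradedOrthonormal u P lev V s)
    (hv : ∀ p, v p = u p + lam * eval 0 p) (hqd : QuasiDefinite v) (n : ℕ) :
    1 + lam * eval 0 (kerAtZero P (s n)) ≠ 0 := by
  intro h0
  have hne : kerAtZero P (s n) ≠ 0 := fun hk => by simp [hk] at h0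
  have hn : n ≠ 0 := by
    rintro rfl
    have : s 0 = ∅ := Finset.eq_empty_of_forall_notMem fun t ht => by simp [h.mem_iff] at ht
    simp [kerAtZero, this] at hne
  have hdeg : (kerAtZero P (s n)).totalDegree ≤ n - 1 := by
    refine totalDegree_finsetSum_le fun t ht => (totalDegree_smul_le _ _).trans ?_
    obtain ⟨htV, htn⟩ := (h.mem_iff _ _).1 ht
    have := h.totalDegree_le t htV
    omega
  obtain ⟨S, hS⟩ := hqd
  obtain ⟨p, hp, hvp⟩ := hS.exists_apply_mul_ne_zero hne
  refine hvp ?_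
  have hspan := h.mem_span (n - 1) p (hp.trans hdeg)
  rw [Nat.sub_add_cancel (Nat.pos_of_ne_zero hn)] at hspan
  refine Submodule.span_induction (p := fun p _ => v (kerAtZero P (s n) * p) = 0)
    ?_ (by simp) (fun p q _ _ hp hq => by rw [mul_add, map_add, hp, hq, add_zero])
    (fun c p _ hp => by rw [mul_smul_comm, map_smul, hp, smul_zero]) hspan
  rintro _ ⟨t, ht, rfl⟩
  obtain ⟨htV, htn⟩ := (h.mem_iff _ _).1 ht
  rw [h.modified_kerAtZero_mul hv n htV, if_pos htn, h0, zero_mul]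

lemma modified_uvarovPoly_mul (h : IsGradedOrthonormal u P lev V s)
    (hv : ∀ p, v p = u p + lam * eval 0 p) (hqd : QuasiDefinite v) {t t' : ι}
    (ht : t ∈ V) (ht' : t' ∈ V) :
    v (uvarovPoly lam P (s (lev t)) t * P t') = if lev t' < lev t then 0 else
      (if t = t' then 1 else 0) +
        lam * eval 0 (P t) * eval 0 (P t') / (1 + lam * eval 0 (kerAtZero P (s (lev t)))) := by
  have hD := h.one_add_ne_zero hv hqd (lev t)
  rw [uvarovPoly, sub_mul, map_sub, smul_mul_assoc, map_smul, h.modified_kerAtZero_mul hv _ ht', hv,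
    h.ortho t ht t' ht', map_mul, smul_eq_mul]
  by_cases hlt : lev t' < lev t
  · have : t ≠ t' := by rintro rfl; exact lt_irrefl _ hlt
    simp only [this, hlt, if_true, if_false]
    field_simp
    ring
  · simp only [hlt, if_false]
    field_simp
    ring

lemma modified_uvarovPoly_mul_uvarovPoly (h : IsGradedOrthonormal u P lev V s)
    (hv : ∀ p, v p = u p + lam * eval 0 p) (hqd : QuasiDefinite v) {t t' : ι}
    (ht : t ∈ V) (ht' : t' ∈ V) (hle : lev t' ≤ lev t) :
    v (uvarovPoly lam P (s (lev t)) t * uvarovPoly lam P (s (lev t')) t') =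
      if lev t' < lev t then 0 else (if t = t' then 1 else 0) +
        lam * eval 0 (P t) * eval 0 (P t') / (1 + lam * eval 0 (kerAtZero P (s (lev t)))) := by
  have hk : v (uvarovPoly lam P (s (lev t)) t * kerAtZero P (s (lev t'))) = 0 := by
    rw [kerAtZero, Finset.mul_sum, map_sum]
    refine Finset.sum_eq_zero fun r hr => ?_
    obtain ⟨hrV, hrl⟩ := (h.mem_iff _ _).1 hr
    rw [mul_smul_comm, map_smul, h.modified_uvarovPoly_mul hv hqd ht hrV,
      if_pos (hrl.trans_le hle), smul_zero]
  rw [← h.modified_uvarovPoly_mul hv hqd ht ht', uvarovPoly.eq_1 lam P (s (lev t')) t', mul_sub,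
    map_sub, mul_smul_comm, map_smul, hk, smul_zero, sub_zero]

/-- At most one member of each level is nonzero at the origin. -/
def NonzeroUnique (P : ι → MvPolynomial (Fin d) ℝ) (lev : ι → ℕ) (V : Set ι) : Prop :=
  ∀ t ∈ V, ∀ t' ∈ V, lev t = lev t' → eval 0 (P t) ≠ 0 → eval 0 (P t') ≠ 0 → t = t'

lemma uvarovPoly_orthogonal (h : IsGradedOrthonormal u P lev V s)
    (hv : ∀ p, v p = u p + lam * eval 0 p) (hqd : QuasiDefinite v)
    (huniq : NonzeroUnique P lev V) {t t' : ι}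
    (ht : t ∈ V) (ht' : t' ∈ V) (hne : t ≠ t') :
    v (uvarovPoly lam P (s (lev t)) t * uvarovPoly lam P (s (lev t')) t') = 0 := by
  wlog hle : lev t' ≤ lev t generalizing t t'
  · rw [mul_comm]
    exact this ht' ht hne.symm (le_of_not_ge hle)
  rw [h.modified_uvarovPoly_mul_uvarovPoly hv hqd ht ht' hle]
  split_ifs with hlt
  · rfl
  · have : eval 0 (P t) = 0 ∨ eval 0 (P t') = 0 := by
      by_contra! hc
      exact hne (huniq t ht t' ht' (by omega) hc.1 hc.2)
    rcases this with h0 | h0 <;> simp only [h0, mul_zero, zero_mul, zero_div, add_zero]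

lemma modified_uvarovPoly_sq (h : IsGradedOrthonormal u P lev V s)
    (hv : ∀ p, v p = u p + lam * eval 0 p) (hqd : QuasiDefinite v) {t : ι} (ht : t ∈ V) :
    v (uvarovPoly lam P (s (lev t)) t * uvarovPoly lam P (s (lev t)) t) =
      1 + lam * eval 0 (P t) * eval 0 (P t) / (1 + lam * eval 0 (kerAtZero P (s (lev t)))) := by
  rw [h.modified_uvarovPoly_mul_uvarovPoly hv hqd ht ht le_rfl, if_neg (lt_irrefl _), if_pos rfl]

lemma subset_succ (h : IsGradedOrthonormal u P lev V s) (n : ℕ) : s n ⊆ s (n + 1) := fun t ht => by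
  rw [h.mem_iff] at ht ⊢
  exact ⟨ht.1, ht.2.trans n.lt_succ_self⟩

lemma kerAtZero_succ (h : IsGradedOrthonormal u P lev V s) (huniq : NonzeroUnique P lev V)
    {t : ι} (ht : t ∈ V) (h0 : eval 0 (P t) ≠ 0) :
    kerAtZero P (s (lev t + 1)) = kerAtZero P (s (lev t)) + eval 0 (P t) • P t := by
  rw [kerAtZero, ← Finset.sum_sdiff (h.subset_succ (lev t)), add_comm]
  congr 1
  refine Finset.sum_eq_single_of_mem t (by simp [h.mem_iff, ht]) fun t' ht' hne => ?_
  simp only [Finset.mem_sdiff, h.mem_iff, not_and, not_lt] at ht'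
  obtain ⟨⟨htV', hlt⟩, hge⟩ := ht'
  have : eval 0 (P t') = 0 := by
    by_contra hc
    exact hne (huniq t' htV' t ht (by have := hge htV'; omega) hc h0)
  rw [this, zero_smul]

lemma kerAtZero_succ_of_forall (h : IsGradedOrthonormal u P lev V s) {n : ℕ}
    (h0 : ∀ t ∈ V, lev t = n → eval 0 (P t) = 0) :
    kerAtZero P (s (n + 1)) = kerAtZero P (s n) := by
  refine (Finset.sum_subset (h.subset_succ n) fun t ht htn => ?_).symm
  simp only [h.mem_iff, not_and, not_lt] at ht htn
  rw [h0 t ht.1 (by have := htn ht.1; omega), zero_smul]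

lemma modified_uvarovPoly_sq_ne_zero (h : IsGradedOrthonormal u P lev V s)
    (hv : ∀ p, v p = u p + lam * eval 0 p) (hqd : QuasiDefinite v)
    (huniq : NonzeroUnique P lev V) {t : ι} (ht : t ∈ V) :
    v (uvarovPoly lam P (s (lev t)) t * uvarovPoly lam P (s (lev t)) t) ≠ 0 := by
  rw [h.modified_uvarovPoly_sq hv hqd ht]
  by_cases h0 : eval 0 (P t) = 0
  · simp only [h0, mul_zero, zero_div, add_zero, ne_eq, one_ne_zero, not_false_eq_true]
  · have hD := h.one_add_ne_zero hv hqd (lev t)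
    have hD' := h.one_add_ne_zero hv hqd (lev t + 1)
    rw [h.kerAtZero_succ huniq ht h0, map_add, smul_eval] at hD'
    intro hc
    apply hD'
    field_simp at hc
    linear_combination hc

lemma mem_span_uvarovPoly (h : IsGradedOrthonormal u P lev V s) (N : ℕ)
    {p : MvPolynomial (Fin d) ℝ} (hp : p.totalDegree ≤ N) :
    p ∈ Submodule.span ℝ ((fun t => uvarovPoly lam P (s (lev t)) t) '' (s (N + 1))) := by
  refine Submodule.span_le.2 ?_ (h.mem_span N p hp)
  rintro _ ⟨t, ht, rfl⟩
  obtain ⟨htV, hlt⟩ := (h.mem_iff _ _).1 ht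
  clear ht
  induction hn : lev t using Nat.strong_induction_on generalizing t with
  | _ n ih =>
    have hP : P t = uvarovPoly lam P (s (lev t)) t + (lam * eval 0 (P t) /
        (1 + lam * eval 0 (kerAtZero P (s (lev t))))) • kerAtZero P (s (lev t)) := by
      rw [uvarovPoly, sub_add_cancel]
    rw [SetLike.mem_coe, hP]
    refine Submodule.add_mem _ (Submodule.subset_span ⟨t, (h.mem_iff _ _).2 ⟨htV, hlt⟩, rfl⟩)
      (Submodule.smul_mem _ _ (Submodule.sum_mem _ fun r hr => Submodule.smul_mem _ _ ?_))
    obtain ⟨hrV, hrl⟩ := (h.mem_iff _ _).1 hr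
    exact ih (lev r) (hn ▸ hrl) r hrV (hrl.trans hlt) rfl

lemma sum_uvarovPoly (h : IsGradedOrthonormal u P lev V s)
    (hv : ∀ p, v p = u p + lam * eval 0 p) (hqd : QuasiDefinite v)
    (huniq : NonzeroUnique P lev V) (n : ℕ) (x y : Fin d → ℝ) :
    ∑ t ∈ s n, eval x (uvarovPoly lam P (s (lev t)) t) * eval y (uvarovPoly lam P (s (lev t)) t) /
        v (uvarovPoly lam P (s (lev t)) t * uvarovPoly lam P (s (lev t)) t) =
      ∑ t ∈ s n, eval x (P t) * eval y (P t) -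
        lam / (1 + lam * eval 0 (kerAtZero P (s n))) *
          (eval x (kerAtZero P (s n)) * eval y (kerAtZero P (s n))) := by
  induction n with
  | zero =>
    have : s 0 = ∅ := Finset.eq_empty_of_forall_notMem fun t ht => by simp [h.mem_iff] at ht
    simp [kerAtZero, this]
  | succ n ih =>
    rw [← Finset.sum_sdiff (h.subset_succ n), ← Finset.sum_sdiff (h.subset_succ n), ih]
    have hmem : ∀ t ∈ s (n + 1) \ s n, t ∈ V ∧ lev t = n := fun t ht => by
      simp only [Finset.mem_sdiff, h.mem_iff, not_and, not_lt] at ht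
      exact ⟨ht.1.1, by have := ht.2 ht.1.1; omega⟩
    have hzero : ∀ t ∈ V, eval 0 (P t) = 0 →
        eval x (uvarovPoly lam P (s (lev t)) t) * eval y (uvarovPoly lam P (s (lev t)) t) /
          v (uvarovPoly lam P (s (lev t)) t * uvarovPoly lam P (s (lev t)) t) -
          eval x (P t) * eval y (P t) = 0 := fun t ht h0 => by
      rw [h.modified_uvarovPoly_sq hv hqd ht]
      simp only [uvarovPoly, h0, mul_zero, zero_div, zero_smul, sub_zero, add_zero, div_one, sub_self]
    suffices ∑ t ∈ s (n + 1) \ s n,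
        (eval x (uvarovPoly lam P (s (lev t)) t) * eval y (uvarovPoly lam P (s (lev t)) t) /
          v (uvarovPoly lam P (s (lev t)) t * uvarovPoly lam P (s (lev t)) t) -
          eval x (P t) * eval y (P t)) =
        lam / (1 + lam * eval 0 (kerAtZero P (s n))) *
          (eval x (kerAtZero P (s n)) * eval y (kerAtZero P (s n))) -
        lam / (1 + lam * eval 0 (kerAtZero P (s (n + 1)))) *
          (eval x (kerAtZero P (s (n + 1))) * eval y (kerAtZero P (s (n + 1)))) by
      rw [Finset.sum_sub_distrib] at this
      linear_combination this
    by_cases hall : ∀ t ∈ V, lev t = n → eval 0 (P t) = 0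
    · rw [h.kerAtZero_succ_of_forall hall, sub_self]
      exact Finset.sum_eq_zero fun t ht =>
        hzero t (hmem t ht).1 (hall t (hmem t ht).1 (hmem t ht).2)
    · push Not at hall
      obtain ⟨t, ht, rfl, h0⟩ := hall
      have hD := h.one_add_ne_zero hv hqd (lev t)
      have hD' := h.one_add_ne_zero hv hqd (lev t + 1)
      rw [Finset.sum_eq_single_of_mem t (by simp [h.mem_iff, ht]) fun t' ht' hne =>
        hzero t' (hmem t' ht').1 ?_, h.modified_uvarovPoly_sq hv hqd ht]
      · rw [h.kerAtZero_succ huniq ht h0] at hD' ⊢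
        simp only [uvarovPoly, map_add, map_sub, smul_eval] at hD' ⊢
        set k := eval 0 (kerAtZero P (s (lev t)))
        set a := eval 0 (P t)
        have hD'' : 1 + lam * a * a / (1 + lam * k) =
            (1 + lam * (k + a * a)) / (1 + lam * k) := by
          field_simp
          ring
        rw [hD'']
        set D := 1 + lam * k with hDdef
        set D' := 1 + lam * (k + a * a) with hDdef'
        have hrel : D' = D + lam * a * a := by rw [hDdef, hDdef']; ring
        field_simp
        rw [hrel]
        ring
      · by_contra hc
        exact hne (huniq t' (hmem t' ht').1 t ht (hmem t' ht').2 hc h0)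

end IsGradedOrthonormal

lemma sigmaH_zero (d : ℕ) : sigmaH d 0 = 1 := by
  have hle : homogeneousSubmodule (Fin d) ℝ 0 ≤ LinearMap.ker (mvLaplacian d) := by
    intro p hp
    obtain ⟨c, rfl⟩ : ∃ c, p = C c := ⟨_, totalDegree_eq_zero_iff_eq_C.1
      ((totalDegree_zero_iff_isHomogeneous (Fin d)).2 hp)⟩
    simp [mvLaplacian]
  rw [sigmaH, inf_eq_left.2 hle, homogeneousSubmodule_zero, Submodule.one_eq_span]
  exact finrank_span_singleton one_ne_zero

lemma IsHarmonicHomogeneous.eval_zero {d m : ℕ} {p : MvPolynomial (Fin d) ℝ}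
    (hp : IsHarmonicHomogeneous p m) (hm : m ≠ 0) : eval 0 p = 0 := by
  have h : coeff 0 p = 0 := hp.1.coeff_eq_zero (by simpa using hm.symm)
  rw [← constantCoeff_eq] at h
  simpa using h

/-- The indices `(m, j, k)` of the ball polynomials of degree `m < n`. -/
def ballIndexLT (sig : ℕ → ℕ) (n : ℕ) : Finset (ℕ × ℕ × ℕ) :=
  (Finset.range n).biUnion fun m => (Finset.range (m / 2 + 1)).biUnion fun j =>
    (Finset.Icc 1 (sig (m - 2 * j))).image fun k => (m, j, k)

lemma mem_ballIndexLT {sig : ℕ → ℕ} {n : ℕ} {t : ℕ × ℕ × ℕ} :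
    t ∈ ballIndexLT sig n ↔
      (2 * t.2.1 ≤ t.1 ∧ 1 ≤ t.2.2 ∧ t.2.2 ≤ sig (t.1 - 2 * t.2.1)) ∧ t.1 < n := by
  obtain ⟨m, j, k⟩ := t
  simp only [ballIndexLT, Finset.mem_biUnion, Finset.mem_range, Finset.mem_image, Finset.mem_Icc,
    Prod.mk.injEq]
  constructor
  · rintro ⟨m', hm, j', hj, k', hk, rfl, rfl, rfl⟩
    exact ⟨⟨by omega, hk.1, hk.2⟩, hm⟩
  · rintro ⟨⟨hj, hk⟩, hm⟩
    exact ⟨m, hm, j, by omega, k, hk, rfl, rfl, rfl⟩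

lemma sum_ballIndexLT {M : Type*} [AddCommMonoid M] (sig : ℕ → ℕ) (n : ℕ)
    (f : ℕ → ℕ → ℕ → M) :
    ∑ t ∈ ballIndexLT sig n, f t.1 t.2.1 t.2.2 =
      ∑ m ∈ Finset.range n, ∑ j ∈ Finset.range (m / 2 + 1),
        ∑ k ∈ Finset.Icc 1 (sig (m - 2 * j)), f m j k := by
  rw [Finset.sum_finset_product (ballIndexLT sig n) (Finset.range n)
    (fun m => (Finset.range (m / 2 + 1)).biUnion fun j =>
      (Finset.Icc 1 (sig (m - 2 * j))).image fun k => (j, k))]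
  · refine Finset.sum_congr rfl fun m _ => ?_
    rw [Finset.sum_finset_product _ (Finset.range (m / 2 + 1))
      (fun j => Finset.Icc 1 (sig (m - 2 * j)))]
    rintro ⟨j, k⟩
    simp
  · rintro ⟨m, j, k⟩
    rw [mem_ballIndexLT]
    simp
    omega

lemma eval_sqNormPoly (d : ℕ) (x : Fin d → ℝ) : eval x (sqNormPoly d) = ∑ i, x i ^ 2 := by
  simp [sqNormPoly]

lemma eval_ballPPoly (d : ℕ) (μ : ℝ) (Y : ℕ → ℕ → MvPolynomial (Fin d) ℝ) (n j k : ℕ)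
    (x : Fin d → ℝ) :
    eval x (ballPPoly d μ Y n j k) = (hjn d μ j n)⁻¹ *
      (jacobiP (μ - 1 / 2) ((n : ℝ) - 2 * (j : ℝ) + ((d : ℝ) - 2) / 2) j
        (2 * (∑ i, x i ^ 2) - 1) * eval x (Y (n - 2 * j) k)) := by
  have h : ∀ q : Polynomial ℝ, eval x (Polynomial.aeval (2 * sqNormPoly d - 1) q) =
      q.eval (2 * (∑ i, x i ^ 2) - 1) := fun q => by
    have := Polynomial.hom_eval₂ q (algebraMap ℝ (MvPolynomial (Fin d) ℝ)) (eval x)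
      (2 * sqNormPoly d - 1)
    rw [Polynomial.aeval_def, this, Polynomial.eval, ← eval_sqNormPoly]
    congr 1
    · ext; simp
    · simp
  rw [ballPPoly, smul_eval, map_mul, h, jacobiP]

lemma natDegree_jacobiPoly_le (α β : ℝ) (n : ℕ) : (jacobiPoly α β n).natDegree ≤ n := by
  refine Polynomial.natDegree_sum_le_of_forall_le _ _ fun s hs => ?_
  have hs : s ≤ n := by simpa [Nat.lt_succ_iff] using hs
  refine (Polynomial.natDegree_mul_le_of_le (m := 0 + s) (n := n - s)
    (Polynomial.natDegree_mul_le_of_le (Polynomial.natDegree_C _).le ?_) ?_).trans (by omega)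
  · compute_degree
  · compute_degree

lemma totalDegree_aeval_le {d : ℕ} (q : Polynomial ℝ) (r : MvPolynomial (Fin d) ℝ) :
    (Polynomial.aeval r q).totalDegree ≤ q.natDegree * r.totalDegree := by
  rw [Polynomial.aeval_eq_sum_range]
  refine totalDegree_finsetSum_le fun i hi => (totalDegree_smul_le _ _).trans
    ((totalDegree_pow _ _).trans (Nat.mul_le_mul_right _ ?_))
  simpa [Nat.lt_succ_iff] using hi

lemma totalDegree_ballPPoly_le {d : ℕ} (μ : ℝ) (Y : ℕ → ℕ → MvPolynomial (Fin d) ℝ)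
    {n j k : ℕ} (hj : 2 * j ≤ n) (hY : (Y (n - 2 * j) k).totalDegree ≤ n - 2 * j) :
    (ballPPoly d μ Y n j k).totalDegree ≤ n := by
  have hr : (2 * sqNormPoly d - 1).totalDegree ≤ 2 := by
    have h1 : (sqNormPoly d).totalDegree ≤ 2 :=
      totalDegree_finsetSum_le fun i _ => (totalDegree_X_pow i 2).le
    have h2 : (2 * sqNormPoly d).totalDegree ≤ 2 := by
      rw [two_mul]
      exact (totalDegree_add _ _).trans (max_le h1 h1)
    exact (totalDegree_sub _ _).trans (max_le h2 (by simp))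
  have hJ := (totalDegree_aeval_le (jacobiPoly (μ - 1 / 2)
    ((n : ℝ) - 2 * (j : ℝ) + ((d : ℝ) - 2) / 2) j) (2 * sqNormPoly d - 1)).trans
    (Nat.mul_le_mul (natDegree_jacobiPoly_le _ _ _) hr)
  refine (totalDegree_smul_le _ _).trans ((totalDegree_mul _ _).trans ?_)
  omega

/-- The kernel with one argument at the origin is a multiple of a radial Jacobi polynomial. -/
lemma eval_kerAtZero_ball {d : ℕ} (hd : 2 ≤ d) {μ : ℝ} (hμ : -(1 / 2) < μ)
    {Y : ℕ → ℕ → MvPolynomial (Fin d) ℝ}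
    (hY : ∀ m k : ℕ, 1 ≤ k → k ≤ sigmaH d m → IsHarmonicHomogeneous (Y m k) m)
    {c : ℝ} (hc : Y 0 1 = C c) (hc1 : c ^ 2 = 1) (n : ℕ) (x : Fin d → ℝ) :
    eval x (kerAtZero (fun t : ℕ × ℕ × ℕ => ballPPoly d μ Y t.1 t.2.1 t.2.2)
        (ballIndexLT (sigmaH d) (n + 1))) =
      poch (μ + ((d : ℝ) + 1) / 2) (n / 2) / poch (μ + 1 / 2) (n / 2) *
        jacobiP ((d : ℝ) / 2) (μ - 1 / 2) (n / 2) (1 - 2 * ∑ i, x i ^ 2) := by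
  rw [show 1 - 2 * ∑ i, x i ^ 2 = -(2 * ∑ i, x i ^ 2 - 1) by ring,
    ← sum_jacobiP_mul_jacobiP_neg_one hd hμ, kerAtZero, map_sum]
  simp only [smul_eval]
  rw [sum_ballIndexLT _ _ fun m j k =>
    eval 0 (ballPPoly d μ Y m j k) * eval x (ballPPoly d μ Y m j k)]
  have hne : ∀ m j : ℕ, m - 2 * j ≠ 0 → ∑ k ∈ Finset.Icc 1 (sigmaH d (m - 2 * j)),
      eval 0 (ballPPoly d μ Y m j k) * eval x (ballPPoly d μ Y m j k) = 0 :=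
    fun m j hm => Finset.sum_eq_zero fun k hk => by
      obtain ⟨hk, hk'⟩ := Finset.mem_Icc.1 hk
      rw [eval_ballPPoly d μ Y m j k 0, (hY _ k hk hk').eval_zero hm, mul_zero, mul_zero, zero_mul]
  have heven : ∀ m : ℕ, ∑ j ∈ Finset.range (2 * m / 2 + 1),
      ∑ k ∈ Finset.Icc 1 (sigmaH d (2 * m - 2 * j)),
        eval 0 (ballPPoly d μ Y (2 * m) j k) * eval x (ballPPoly d μ Y (2 * m) j k) =
      (hjn d μ m (2 * m) ^ 2)⁻¹ *
        jacobiP (μ - 1 / 2) (((d : ℝ) - 2) / 2) m (-1) *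
        jacobiP (μ - 1 / 2) (((d : ℝ) - 2) / 2) m (2 * ∑ i, x i ^ 2 - 1) := fun m => by
    rw [Nat.mul_div_cancel_left m two_pos, Finset.sum_eq_single_of_mem m (by simp)
      fun j hj hjm => hne _ _ (by simp at hj; omega), Nat.sub_self, sigmaH_zero, Finset.Icc_self,
      Finset.sum_singleton, eval_ballPPoly, eval_ballPPoly, Nat.sub_self, hc, eval_C, eval_C]
    have h0 : 2 * ∑ i, (0 : Fin d → ℝ) i ^ 2 - 1 = -1 := by simp
    rw [h0, Nat.cast_mul, Nat.cast_two, sub_self, zero_add, ← inv_pow]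
    linear_combination ((hjn d μ m (2 * m))⁻¹ ^ 2 *
        jacobiP (μ - 1 / 2) (((d : ℝ) - 2) / 2) m (-1) *
        jacobiP (μ - 1 / 2) (((d : ℝ) - 2) / 2) m (2 * ∑ i, x i ^ 2 - 1)) * hc1
  induction n with
  | zero =>
    simpa using heven 0
  | succ n ih =>
    rw [Finset.sum_range_succ, ih]
    obtain ⟨m, hm | hm⟩ := Nat.even_or_odd' (n + 1)
    · rw [hm, heven, show n / 2 + 1 = m by omega, Nat.mul_div_cancel_left m two_pos,
        Finset.sum_range_succ]
    · rw [Finset.sum_eq_zero fun j hj => hne _ _ (by simp at hj; omega), add_zero,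
        show n / 2 = (n + 1) / 2 by omega]

/-- Theorem 5.2.  Let `v = u_μ + λδ_0` be quasi-definite.  Then the
polynomials `Q^n_{j,k}` form an orthogonal basis with respect to `v`, and the kernels
satisfy `K_n(v;x,y) = K_n(u_μ;x,y) - b_nP_{⌊n/2⌋}^{(d/2,μ-1/2)}(1-2‖x‖²)P_{⌊n/2⌋}^{(d/2,μ-1/2)}(1-2‖y‖²)`
with `b_n = (λ/(1+λK_n(u_μ;0,0)))·[(μ+(d+1)/2)_{⌊n/2⌋}/(μ+1/2)_{⌊n/2⌋}]²`. -/
theorem ball_uvarov_basis_and_kernel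
    {d : ℕ} (hd : 2 ≤ d) {μ : ℝ} (hμ : -(1 / 2) < μ) (lam : ℝ) (hlam : lam ≠ 0)
    (u v : MvPolynomial (Fin d) ℝ →ₗ[ℝ] ℝ)
    (hu : IsBallFunctional d μ u)
    (hv : ∀ p : MvPolynomial (Fin d) ℝ, v p = u p + lam * eval 0 p)
    (hvqd : QuasiDefinite v)
    (Y : ℕ → ℕ → MvPolynomial (Fin d) ℝ)
    (hY : ∀ m k : ℕ, 1 ≤ k → k ≤ sigmaH d m → IsHarmonicHomogeneous (Y m k) m)
    (Pf : ℕ → ℕ → ℕ → MvPolynomial (Fin d) ℝ) (hPf : Pf = ballPPoly d μ Y)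
    -- `{P^n_{j,k}}` is an orthonormal basis with respect to `u_μ`:
    (hortho : ∀ n j k n' j' k' : ℕ,
      2 * j ≤ n → 1 ≤ k → k ≤ sigmaH d (n - 2 * j) →
      2 * j' ≤ n' → 1 ≤ k' → k' ≤ sigmaH d (n' - 2 * j') →
      u (Pf n j k * Pf n' j' k') = if (n, j, k) = (n', j', k') then 1 else 0)
    (hspan : ∀ (N : ℕ) (p : MvPolynomial (Fin d) ℝ), p.totalDegree ≤ N →
      p ∈ Submodule.span ℝ {q | ∃ n ≤ N, ∃ j k : ℕ,
        2 * j ≤ n ∧ 1 ≤ k ∧ k ≤ sigmaH d (n - 2 * j) ∧ q = Pf n j k}) :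
    -- the `Q^n_{j,k}` are mutually orthogonal with respect to `v` …
    (∀ n j k n' j' k' : ℕ,
      2 * j ≤ n → 1 ≤ k → k ≤ sigmaH d (n - 2 * j) →
      2 * j' ≤ n' → 1 ≤ k' → k' ≤ sigmaH d (n' - 2 * j') →
      (n, j, k) ≠ (n', j', k') →
      v (ballUvarovQ lam Pf (sigmaH d) n j k * ballUvarovQ lam Pf (sigmaH d) n' j' k') = 0) ∧
    -- … with nonzero norms …
    (∀ n j k : ℕ, 2 * j ≤ n → 1 ≤ k → k ≤ sigmaH d (n - 2 * j) →
      v (ballUvarovQ lam Pf (sigmaH d) n j k * ballUvarovQ lam Pf (sigmaH d) n j k) ≠ 0) ∧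
    -- … and they span, so they form an orthogonal basis with respect to `v`;
    (∀ (N : ℕ) (p : MvPolynomial (Fin d) ℝ), p.totalDegree ≤ N →
      p ∈ Submodule.span ℝ {q | ∃ n ≤ N, ∃ j k : ℕ,
        2 * j ≤ n ∧ 1 ≤ k ∧ k ≤ sigmaH d (n - 2 * j) ∧
          q = ballUvarovQ lam Pf (sigmaH d) n j k}) ∧
    -- the kernels of `v` and `u_μ` are related as announced:
    (∀ (n : ℕ) (x y : Fin d → ℝ),
      (∑ m ∈ Finset.range (n + 1), ∑ j ∈ Finset.range (m / 2 + 1),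
        ∑ k ∈ Finset.Icc 1 (sigmaH d (m - 2 * j)),
          eval x (ballUvarovQ lam Pf (sigmaH d) m j k) *
            eval y (ballUvarovQ lam Pf (sigmaH d) m j k) /
          v (ballUvarovQ lam Pf (sigmaH d) m j k * ballUvarovQ lam Pf (sigmaH d) m j k)) =
      famKerLT Pf (sigmaH d) (n + 1) x y -
        (lam / (1 + lam * famKerLT Pf (sigmaH d) (n + 1) 0 0)) *
          (poch (μ + ((d : ℝ) + 1) / 2) (n / 2) / poch (μ + 1 / 2) (n / 2)) ^ 2 *
          (jacobiP ((d : ℝ) / 2) (μ - 1 / 2) (n / 2) (1 - 2 * ∑ i, x i ^ 2) *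
            jacobiP ((d : ℝ) / 2) (μ - 1 / 2) (n / 2) (1 - 2 * ∑ i, y i ^ 2))) := by
  subst hPf
  set P : ℕ × ℕ × ℕ → MvPolynomial (Fin d) ℝ := fun t => ballPPoly d μ Y t.1 t.2.1 t.2.2 with hP
  set V : Set (ℕ × ℕ × ℕ) :=
    {t | 2 * t.2.1 ≤ t.1 ∧ 1 ≤ t.2.2 ∧ t.2.2 ≤ sigmaH d (t.1 - 2 * t.2.1)} with hV
  set s := ballIndexLT (sigmaH d) with hs
  have hmem : ∀ n j k, 2 * j ≤ n → 1 ≤ k → k ≤ sigmaH d (n - 2 * j) → (n, j, k) ∈ V :=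
    fun n j k h1 h2 h3 => ⟨h1, h2, h3⟩
  have hG : IsGradedOrthonormal u P Prod.fst V s :=
    { mem_iff := fun t n => mem_ballIndexLT
      ortho := fun t ht t' ht' => hortho _ _ _ _ _ _ ht.1 ht.2.1 ht.2.2 ht'.1 ht'.2.1 ht'.2.2
      totalDegree_le := fun t ht =>
        totalDegree_ballPPoly_le μ Y ht.1 (hY _ _ ht.2.1 ht.2.2).1.totalDegree_le
      mem_span := fun N p hp => by
        refine Submodule.span_mono ?_ (hspan N p hp)
        rintro _ ⟨n, hn, j, k, h1, h2, h3, rfl⟩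
        exact ⟨(n, j, k), mem_ballIndexLT.2 ⟨⟨h1, h2, h3⟩, Nat.lt_succ_of_le hn⟩, rfl⟩ }
  have hspecial : ∀ t ∈ V, eval 0 (P t) ≠ 0 → t.1 = 2 * t.2.1 ∧ t.2.2 = 1 := by
    rintro ⟨n, j, k⟩ ⟨h1, h2, h3⟩ h0
    simp only at h1 h2 h3 ⊢
    have hn : n - 2 * j = 0 := by
      by_contra hne
      apply h0
      simp only [hP]
      rw [eval_ballPPoly, (hY _ k h2 h3).eval_zero hne, mul_zero, mul_zero]
    rw [hn, sigmaH_zero] at h3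
    omega
  have huniq : IsGradedOrthonormal.NonzeroUnique P Prod.fst V := by
    intro t ht t' ht' hlev h0 h0'
    obtain ⟨h1, h2⟩ := hspecial t ht h0
    obtain ⟨h1', h2'⟩ := hspecial t' ht' h0'
    exact Prod.ext hlev (Prod.ext (by omega) (by omega))
  have hkerLT : ∀ n x y, famKerLT (ballPPoly d μ Y) (sigmaH d) n x y =
      ∑ t ∈ s n, eval x (P t) * eval y (P t) := fun n x y =>
    (sum_ballIndexLT (sigmaH d) n fun m j k =>
      eval x (ballPPoly d μ Y m j k) * eval y (ballPPoly d μ Y m j k)).symm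
  have hkerPoly : ∀ n, famKerPolyLT (ballPPoly d μ Y) (sigmaH d) n = kerAtZero P (s n) := fun n =>
    (sum_ballIndexLT (sigmaH d) n fun m j k =>
      eval 0 (ballPPoly d μ Y m j k) • ballPPoly d μ Y m j k).symm
  have hker0 : ∀ n, famKerLT (ballPPoly d μ Y) (sigmaH d) n 0 0 =
      eval 0 (kerAtZero P (s n)) := fun n => by
    rw [hkerLT, kerAtZero, map_sum]
    exact Finset.sum_congr rfl fun t _ => by rw [smul_eval]
  have hQ : ∀ t ∈ V, ballUvarovQ lam (ballPPoly d μ Y) (sigmaH d) t.1 t.2.1 t.2.2 =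
      uvarovPoly lam P (s t.1) t := by
    rintro ⟨n, j, k⟩ ht
    rw [ballUvarovQ, uvarovPoly, hker0, hkerPoly]
    split_ifs with h
    · obtain ⟨-, h1, h2⟩ := h
      simp only at h1 h2
      subst h1 h2
      rfl
    · have h0 : eval 0 (P (n, j, k)) = 0 := by
        by_contra hc
        have := hspecial _ ht hc
        simp only at this h
        exact h ⟨⟨j, by omega⟩, by omega, this.2⟩
      rw [h0, mul_zero, zero_div, zero_smul, sub_zero]
  obtain ⟨c, hc⟩ : ∃ c, Y 0 1 = C c := ⟨_, totalDegree_eq_zero_iff_eq_C.1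
    ((totalDegree_zero_iff_isHomogeneous (Fin d)).2 (hY 0 1 le_rfl (sigmaH_zero d).ge).1)⟩
  have hc1 : c ^ 2 = 1 := by
    have h1 := hortho 0 0 1 0 0 1 le_rfl le_rfl (sigmaH_zero d).ge le_rfl le_rfl (sigmaH_zero d).ge
    have h2 : (ballPPoly d μ Y 0 0 1).totalDegree = 0 := Nat.le_zero.1 <|
      hG.totalDegree_le (0, 0, 1) (hmem 0 0 1 le_rfl le_rfl (sigmaH_zero d).ge)
    rw [totalDegree_eq_zero_iff_eq_C] at h2
    set a := coeff 0 (ballPPoly d μ Y 0 0 1)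
    have h3 : a = (hjn d μ 0 0)⁻¹ * c := by
      have := eval_ballPPoly d μ Y 0 0 1 0
      rw [h2, eval_C, jacobiP_eq_sum, mul_zero, Nat.sub_zero, hc, eval_C] at this
      simpa [genBinom_zero] using this
    have h4 : hjn d μ 0 0 ^ 2 = 1 := by
      have hd' : (2 : ℝ) ≤ d := by exact_mod_cast hd
      have h5 : μ + ((d : ℝ) - 1) / 2 ≠ 0 := by linarith
      simpa [poch, h5] using hjn_two_mul_sq hd hμ 0
    rw [if_pos rfl, h2, ← C_mul, ← mul_one (C (a * a)), ← smul_eq_C_mul, map_smul,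
      IsBallFunctional.map_one (by omega) hμ hu, smul_eq_mul, mul_one, h3] at h1
    have h6 : hjn d μ 0 0 ≠ 0 := fun h => by simp [h] at h4
    field_simp at h1
    rw [h1, h4]
  refine ⟨?_, ?_, ?_, ?_⟩
  · intro n j k n' j' k' h1 h2 h3 h1' h2' h3' hne
    have ht := hmem n j k h1 h2 h3
    have ht' := hmem n' j' k' h1' h2' h3'
    have := hG.uvarovPoly_orthogonal hv hvqd huniq ht ht' hne
    rwa [← hQ _ ht, ← hQ _ ht'] at this
  · intro n j k h1 h2 h3
    have ht := hmem n j k h1 h2 h3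
    have := hG.modified_uvarovPoly_sq_ne_zero hv hvqd huniq ht
    rwa [← hQ _ ht] at this
  · intro N p hp
    refine Submodule.span_mono ?_ (hG.mem_span_uvarovPoly (lam := lam) N hp)
    rintro _ ⟨t, ht, rfl⟩
    obtain ⟨htV, hlt⟩ := (hG.mem_iff _ _).1 ht
    exact ⟨t.1, Nat.le_of_lt_succ hlt, t.2.1, t.2.2, htV.1, htV.2.1, htV.2.2, (hQ t htV).symm⟩
  · intro n x y
    have h := hG.sum_uvarovPoly hv hvqd huniq (n + 1) x y
    rw [← sum_ballIndexLT (sigmaH d) (n + 1) fun m j k =>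
      eval x (ballUvarovQ lam (ballPPoly d μ Y) (sigmaH d) m j k) *
        eval y (ballUvarovQ lam (ballPPoly d μ Y) (sigmaH d) m j k) /
        v (ballUvarovQ lam (ballPPoly d μ Y) (sigmaH d) m j k *
          ballUvarovQ lam (ballPPoly d μ Y) (sigmaH d) m j k),
      Finset.sum_congr rfl fun t ht => by rw [hQ t ((hG.mem_iff _ _).1 ht).1], h, hkerLT, hker0,
      eval_kerAtZero_ball hd hμ hY hc hc1 n x, eval_kerAtZero_ball hd hμ hY hc hc1 n y]
    ring
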